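/- Let L³ = {x ∈ ℝ³ : √(x₁² + x₂²) ≤ x₃} be the 3-dimensional Lorentz cone. There is no function f : ℝ³ → ℝ that is subadditive, nondecreasing with respect to L³, and satisfies f(0,0,0) = 0, f(1,0,1) = −f(−1,0,−1) = 0 and f(0,1,0) = −f(0,−1,0) = 1. In other words, the subadditive dual of the conic MIP inf{x₂ : (x₁, x₂, x₁) ∈ L³, (x₁,x₂) ∈ ℤ²} is infeasible. -/

import Mathlib

/-!
STATEMENT 17: The subadditive dual of the conic MIP
`inf {x₂ : (x₁, x₂, x₁) ∈ L³, (x₁, x₂) ∈ ℤ²}` is infeasible: no subadditive function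
nondecreasing with respect to the Lorentz cone `L³` satisfies `f 0 = 0`,
`f(1,0,1) = -f(-1,0,-1) = 0` and `f(0,1,0) = -f(0,-1,0) = 1`.
-/

/-- The 3-dimensional Lorentz cone `L³ = {x ∈ ℝ³ : √(x₁² + x₂²) ≤ x₃}`. -/
def LorentzCone3 : Set (Fin 3 → ℝ) :=
  {x | Real.sqrt ((x 0) ^ 2 + (x 1) ^ 2) ≤ x 2}

theorem subadditive_nsmul_le {M : Type*} [AddMonoid M] {f : M → ℝ}
    (hf : ∀ u v, f (u + v) ≤ f u + f v) (h0 : f 0 = 0) (n : ℕ) (u : M) :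
    f (n • u) ≤ n * f u := by
  induction n with
  | zero => simp [h0]
  | succ k ih =>
    have h := hf (k • u) u
    rw [succ_nsmul]
    push_cast
    linarith

theorem lorentz_subadditive_dual_infeasible :
    ¬ ∃ f : (Fin 3 → ℝ) → ℝ,
      (∀ u v, f (u + v) ≤ f u + f v) ∧
      (∀ u v, u - v ∈ LorentzCone3 → f v ≤ f u) ∧
      f 0 = 0 ∧
      f ![1, 0, 1] = 0 ∧ f ![-1, 0, -1] = 0 ∧
      f ![0, 1, 0] = 1 ∧ f ![0, -1, 0] = -1 := by
  rintro ⟨f, hsub, hmono, h0, hA, -, -, hB⟩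
  -- `(m², -m, m² + 1) ∈ L³` forces `m ≤ f (0, 0, 1)` for every natural number `m`.
  obtain ⟨m, hm⟩ := exists_nat_gt (f ![0, 0, 1])
  have hcone : (m ^ 2) • ![1, 0, 1] + m • ![0, -1, 0] + ![0, 0, 1] - 0 ∈ LorentzCone3 := by
    refine Real.sqrt_le_iff.mpr ⟨?_, ?_⟩
    · simp
      positivity
    · simp
      nlinarith [sq_nonneg (m : ℝ)]
  have hpos := hmono _ _ hcone
  have hsum := hsub ((m ^ 2) • ![1, 0, 1] + m • ![0, -1, 0]) ![0, 0, 1]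
  have hsum' := hsub ((m ^ 2) • ![1, 0, 1]) (m • ![0, -1, 0])
  have hnA := subadditive_nsmul_le hsub h0 (m ^ 2) ![1, 0, 1]
  have hnB := subadditive_nsmul_le hsub h0 m ![0, -1, 0]
  rw [hA] at hnA
  rw [hB] at hnB
  linarith
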